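/- Let X be a separable real Banach space, let f : X → ℝ be quasiconvex and densely continuous, and let m ∈ ℝ be the topological essential infimum of f. If F_m = {x ∈ X : f(x) < m} is nowhere dense, then there exist an open dense set U ⊆ X and an Aronszajn null set N ⊆ X such that f is Hadamard differentiable at every point of U \ N. -/

import Mathlib

open Filter Topology Set MeasureTheory

/-- `f` is quasiconvex: `f (l•x + (1-l)•y) ≤ max (f x) (f y)` for `l ∈ [0,1]`. -/
def QuasiconvexFun {X : Type*} [AddCommGroup X] [Module ℝ X] (f : X → ℝ) : Prop :=
  ∀ x y : X, ∀ l : ℝ, l ∈ Set.Icc (0 : ℝ) 1 →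
    f (l • x + (1 - l) • y) ≤ max (f x) (f y)

/-- `f` is strictly quasiconvex. -/
def StrictlyQuasiconvexFun {X : Type*} [AddCommGroup X] [Module ℝ X] (f : X → ℝ) : Prop :=
  ∀ x y : X, x ≠ y → ∀ l : ℝ, l ∈ Set.Ioo (0 : ℝ) 1 →
    f (l • x + (1 - l) • y) < max (f x) (f y)

/-- `f` is densely continuous: its set of points of continuity is dense. -/
def DenselyContinuous {X : Type*} [TopologicalSpace X] (f : X → ℝ) : Prop :=
  Dense {x : X | ContinuousAt f x}

/-- `m` is the topological essential infimum of `f`: the strict sublevel set `{f < α}`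
is meager for `α < m` and nonmeager for `α > m`. -/
def IsTopEssInf {X : Type*} [TopologicalSpace X] (f : X → ℝ) (m : ℝ) : Prop :=
  (∀ α : ℝ, α < m → IsMeagre {x : X | f x < α}) ∧
  (∀ α : ℝ, m < α → ¬ IsMeagre {x : X | f x < α})

/-- Aronszajn null set: a Borel set `N` such that for every sequence `ξ` with dense linear
span, `N` decomposes as a countable union of Borel sets, the `n`-th of which has Lebesgue
null intersection with every line of direction `ξ n`. -/
def AronszajnNull {X : Type*} [NormedAddCommGroup X] [NormedSpace ℝ X]
    [MeasurableSpace X] (N : Set X) : Prop :=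
  MeasurableSet N ∧
  ∀ ξ : ℕ → X, Dense (Submodule.span ℝ (Set.range ξ) : Set X) →
    ∃ Nn : ℕ → Set X, N = ⋃ n, Nn n ∧
      ∀ n, MeasurableSet (Nn n) ∧
        ∀ x : X, MeasureTheory.volume {t : ℝ | x + t • ξ n ∈ Nn n} = 0

/-- Haar null set: `E` is contained in a Borel set `B` for which there is a Borel
probability measure vanishing on all translates of `B`. -/
def HaarNull {X : Type*} [AddCommGroup X] [TopologicalSpace X]
    [MeasurableSpace X] (E : Set X) : Prop :=
  ∃ B : Set X, E ⊆ B ∧ MeasurableSet B ∧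
    ∃ μ : MeasureTheory.Measure X, MeasureTheory.IsProbabilityMeasure μ ∧
      ∀ x : X, μ ((fun y => x + y) '' B) = 0

/-- Hadamard differentiability of `f` at `x`. -/
def HadamardDiffAt {X : Type*} [NormedAddCommGroup X] [NormedSpace ℝ X]
    (f : X → ℝ) (x : X) : Prop :=
  ∃ L : X →L[ℝ] ℝ, ∀ h : X, ∀ t : ℕ → ℝ, (∀ n, t n ≠ 0) →
    Tendsto t atTop (𝓝 0) → ∀ hs : ℕ → X, Tendsto hs atTop (𝓝 h) →
      Tendsto (fun n => (f (x + t n • hs n) - f x) / t n) atTop (𝓝 (L h))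

/-- Hadamard differentiability at `x` of a function whose relevant values are those on `V`. -/
def HadamardDiffWithinAt {X : Type*} [NormedAddCommGroup X] [NormedSpace ℝ X]
    (f : X → ℝ) (V : Set X) (x : X) : Prop :=
  ∃ L : X →L[ℝ] ℝ, ∀ h : X, ∀ t : ℕ → ℝ, (∀ n, t n ≠ 0) →
    Tendsto t atTop (𝓝 0) → ∀ hs : ℕ → X, Tendsto hs atTop (𝓝 h) →
      (∀ n, x + t n • hs n ∈ V) →
      Tendsto (fun n => (f (x + t n • hs n) - f x) / t n) atTop (𝓝 (L h))

/-- Gâteaux differentiability of `f` at `x` with derivative `L`. -/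
def GateauxDiffAt {X : Type*} [NormedAddCommGroup X] [NormedSpace ℝ X]
    (f : X → ℝ) (x : X) (L : X →L[ℝ] ℝ) : Prop :=
  ∀ h : X, Tendsto (fun t : ℝ => (f (x + t • h) - f x) / t) (𝓝[≠] 0) (𝓝 (L h))

/-- Essential Gâteaux differentiability of `f` at `x`: directional derivatives exist and
are given by a continuous linear functional for a comeager (residual) set of directions
in the unit sphere. -/
def EssGateauxDiffAt {X : Type*} [NormedAddCommGroup X] [NormedSpace ℝ X]
    (f : X → ℝ) (x : X) : Prop :=
  ∃ L : X →L[ℝ] ℝ, ∃ Ω : Set (Metric.sphere (0 : X) 1), IsMeagre Ωᶜ ∧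
    ∀ h ∈ Ω, Tendsto (fun t : ℝ => (f (x + t • (h : X)) - f x) / t) (𝓝[≠] 0) (𝓝 (L (h : X)))

/-- `K` is a closed convex cone. -/
def IsClosedConvexCone {X : Type*} [NormedAddCommGroup X] [NormedSpace ℝ X] (K : Set X) : Prop :=
  IsClosed K ∧ Convex ℝ K ∧ ∀ l : ℝ, 0 ≤ l → ∀ k ∈ K, l • k ∈ K

/-- `f` is `K`-nondecreasing on `U`. -/
def KNondecreasingOn {X : Type*} [AddCommGroup X] [Module ℝ X]
    (f : X → ℝ) (K U : Set X) : Prop :=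
  ∀ u ∈ U, ∀ k ∈ K, k ≠ 0 → u + k ∈ U → f u ≤ f (u + k)

/-- Ideally convex subset: stable under infinite convex combinations of bounded sequences. -/
def IdeallyConvex {X : Type*} [NormedAddCommGroup X] [NormedSpace ℝ X] (C : Set X) : Prop :=
  ∀ (x : ℕ → X) (lam : ℕ → ℝ), (∀ n, x n ∈ C) → Bornology.IsBounded (Set.range x) →
    (∀ n, lam n ∈ Set.Icc (0 : ℝ) 1) → HasSum lam 1 →
      ∑' n, lam n • x n ∈ C

/-- `C‡`: the union, over finite dimensional subspaces `Z ⊆ X`, of the closures of `C ∩ Z`. -/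
def Ddag {X : Type*} [NormedAddCommGroup X] [NormedSpace ℝ X] (C : Set X) : Set X :=
  ⋃ (Z : Submodule ℝ X) (_ : FiniteDimensional ℝ Z), closure (C ∩ (Z : Set X))

/-- A normed space is reflexive if the canonical inclusion into its double dual is onto. -/
def IsReflexiveSpace (X : Type*) [NormedAddCommGroup X] [NormedSpace ℝ X] : Prop :=
  Function.Surjective (NormedSpace.inclusionInDoubleDual ℝ X)

section Aux

variable {X : Type*} [NormedAddCommGroup X] [NormedSpace ℝ X]

/-- `N` is null on all translates of the span of the first `n` vectors. -/
def NullFor (ξ : ℕ → X) (n : ℕ) (N : Set X) : Prop :=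
  ∀ x : X, volume {t : Fin n → ℝ | x + ∑ i, t i • ξ i ∈ N} = 0

/-- Decomposability with respect to `ξ`. -/
def Dec [MeasurableSpace X] (ξ : ℕ → X) (N : Set X) : Prop :=
  ∃ Nn : ℕ → Set X, N = ⋃ n, Nn n ∧
      ∀ n, MeasurableSet (Nn n) ∧
        ∀ x : X, MeasureTheory.volume {t : ℝ | x + t • ξ n ∈ Nn n} = 0

lemma Dec.iUnion [MeasurableSpace X] {ι : Type*} [Countable ι] {ξ : ℕ → X} {N : ι → Set X}
    (h : ∀ i, Dec ξ (N i)) : Dec ξ (⋃ i, N i) := by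
  choose M hM hM2 using h
  refine ⟨fun n => ⋃ i, M i n, ?_, fun n => ⟨MeasurableSet.iUnion fun i => (hM2 i n).1, ?_⟩⟩
  · rw [iUnion_comm]
    exact iUnion_congr hM
  · intro x
    have : {t : ℝ | x + t • ξ n ∈ ⋃ i, M i n} = ⋃ i, {t : ℝ | x + t • ξ n ∈ M i n} := by
      ext t; simp
    rw [this]
    exact measure_iUnion_null fun i => (hM2 i n).2 x

lemma Dec.inter [MeasurableSpace X] {ξ : ℕ → X} {N B : Set X}
    (h : Dec ξ N) (hB : MeasurableSet B) : Dec ξ (B ∩ N) := by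
  obtain ⟨M, hM, hM2⟩ := h
  refine ⟨fun n => B ∩ M n, ?_, fun n => ⟨hB.inter (hM2 n).1, fun x => ?_⟩⟩
  · rw [hM, inter_iUnion]
  · exact measure_mono_null (fun t ht => ht.2) ((hM2 n).2 x)

lemma Dec.union [MeasurableSpace X] {ξ : ℕ → X} {N B : Set X}
    (h : Dec ξ N) (hB : Dec ξ B) : Dec ξ (N ∪ B) := by
  rw [union_eq_iUnion]
  exact Dec.iUnion (by rintro (_|_) <;> assumption)

variable [MeasurableSpace X] [BorelSpace X] [SecondCountableTopology X]

lemma NullFor.dec {ξ : ℕ → X} : ∀ (n : ℕ) (N : Set X), MeasurableSet N → NullFor ξ n N →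
    Dec ξ N := by
  intro n
  induction n with
  | zero =>
    intro N hN h
    have : N = ∅ := by
      by_contra hne
      obtain ⟨x, hx⟩ := nonempty_iff_ne_empty.2 hne
      have := h x
      simp only [Finset.univ_eq_empty, Finset.sum_empty, add_zero, hx] at this
      have h2 : (volume : Measure (Fin 0 → ℝ)) univ = 0 := by simpa only [ofPred_true] using this
      rw [volume_pi, Measure.pi_of_empty] at h2
      simp at h2
    refine ⟨fun _ => ∅, by simp [this], fun n => by simp⟩
  | succ n ih =>
    intro N hN h
    have hmeas : MeasurableSet {p : X × ℝ | p.1 + p.2 • ξ n ∈ N} := by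
      have : Measurable fun p : X × ℝ => p.1 + p.2 • ξ n := by fun_prop
      exact this hN
    have hφ : Measurable fun x : X => volume {t : ℝ | x + t • ξ n ∈ N} :=
      measurable_measure_prodMk_left hmeas
    set Z : Set X := {x | volume {t : ℝ | x + t • ξ n ∈ N} = 0} with hZ
    have hZm : MeasurableSet Z := hφ (measurableSet_singleton 0)
    have hdec1 : Dec ξ (N ∩ Z) := by
      refine ⟨fun k => if k = n then N ∩ Z else ∅, ?_, fun k => ?_⟩
      · ext x
        simp only [mem_iUnion]
        constructor
        · intro hx
          exact ⟨n, by simpa using hx⟩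
        · rintro ⟨k, hk⟩
          by_cases hkn : k = n
          · simpa [hkn] using hk
          · simp [hkn] at hk
      · by_cases hk : k = n
        · subst hk
          simp only [if_true]
          refine ⟨hN.inter hZm, fun x => ?_⟩
          by_cases hx : volume {t : ℝ | x + t • ξ k ∈ N} = 0
          · exact measure_mono_null (fun t ht => ht.1) hx
          · convert measure_empty (μ := (volume : Measure ℝ))
            rw [eq_empty_iff_forall_notMem]
            rintro t ⟨_, ht⟩
            apply hx
            have h1 : volume {s : ℝ | (x + t • ξ k) + s • ξ k ∈ N} = 0 := ht
            have h2 : {s : ℝ | (x + t • ξ k) + s • ξ k ∈ N}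
                = (fun s => t + s) ⁻¹' {t : ℝ | x + t • ξ k ∈ N} := by
              ext s; simp [add_smul, add_assoc]
            rwa [h2, measure_preimage_add] at h1
        · simp [hk]
    have hdec2 : Dec ξ (N ∩ Zᶜ) := by
      refine ih _ (hN.inter hZm.compl) fun x => ?_
      have hx := h x
      have hmp := (volume_preserving_piFinSuccAbove (fun _ : Fin (n+1) => ℝ) (Fin.last n)).symm
      have hA : MeasurableSet {t : Fin (n+1) → ℝ | x + ∑ i, t i • ξ i ∈ N} := by
        have : Measurable fun t : Fin (n+1) → ℝ => x + ∑ i, t i • ξ i := by fun_prop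
        exact this hN
      rw [← hmp.measure_preimage hA.nullMeasurableSet, Measure.volume_eq_prod,
        Measure.prod_apply_symm (hmp.measurable hA),
        lintegral_eq_zero_iff (measurable_measure_prodMk_right (hmp.measurable hA))] at hx
      refine measure_mono_null ?_ hx
      intro t ht
      simp only [mem_ofPred_eq] at ht
      simp only [mem_compl_iff, mem_ofPred_eq]
      intro h0
      rw [Pi.zero_apply] at h0
      apply ht.2
      rw [hZ, mem_ofPred_eq]
      convert h0 using 2
      ext s
      simp [MeasurableEquiv.piFinSuccAbove, Fin.sum_univ_castSucc, add_assoc]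
    have : N = (N ∩ Z) ∪ (N ∩ Zᶜ) := by simp
    rw [this]
    exact hdec1.union hdec2

lemma nullFor_of_line {ξ : ℕ → X} {n : ℕ} {N : Set X} (hN : MeasurableSet N) (c : Fin n → ℝ)
    (h : ∀ x : X, volume {s : ℝ | x + s • (∑ i, c i • ξ i) ∈ N} = 0) : NullFor ξ n N := by
  intro x
  set A := {t : Fin n → ℝ | x + ∑ i, t i • ξ i ∈ N} with hAdef
  have hA : MeasurableSet A := by
    have : Measurable fun t : Fin n → ℝ => x + ∑ i, t i • ξ i := by fun_prop
    exact this hN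
  have hB : MeasurableSet {p : ℝ × (Fin n → ℝ) | p.2 + p.1 • c ∈ A} := by
    have : Measurable fun p : ℝ × (Fin n → ℝ) => p.2 + p.1 • c := by fun_prop
    exact this hA
  have h0 : (volume : Measure (ℝ × (Fin n → ℝ))) {p : ℝ × (Fin n → ℝ) | p.2 + p.1 • c ∈ A} = 0 := by
    rw [Measure.volume_eq_prod, Measure.prod_apply_symm hB]
    rw [lintegral_eq_zero_iff (measurable_measure_prodMk_right hB)]
    refine Eventually.of_forall fun t => ?_
    have := h (x + ∑ i, t i • ξ i)
    simp only [Pi.zero_apply]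
    convert this using 2
    ext s
    simp [hAdef, add_smul, Finset.sum_add_distrib, Finset.smul_sum, add_assoc, mul_smul]
  rw [Measure.volume_eq_prod, Measure.measure_prod_null hB] at h0
  have : ∃ s : ℝ, volume (Prod.mk s ⁻¹' {p : ℝ × (Fin n → ℝ) | p.2 + p.1 • c ∈ A}) = 0 := h0.exists
  obtain ⟨s, hs⟩ := this
  have h2 : Prod.mk s ⁻¹' {p : ℝ × (Fin n → ℝ) | p.2 + p.1 • c ∈ A} = (fun t => t + s • c) ⁻¹' A := rfl
  rwa [h2, measure_preimage_add_right] at hs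

end Aux

section Aux2

variable {X : Type*} [NormedAddCommGroup X] [NormedSpace ℝ X]

lemma mem_span_rep {ξ : ℕ → X} {h : X} (hh : h ∈ Submodule.span ℝ (range ξ)) :
    ∃ (c : ℕ → ℝ) (n₀ : ℕ), ∀ n, n₀ ≤ n → ∑ i : Fin n, c i • ξ i = h := by
  obtain ⟨c, rfl⟩ := (Finsupp.mem_span_range_iff_exists_finsupp).1 hh
  refine ⟨c, c.support.sup id + 1, fun n hn => ?_⟩
  rw [Fin.sum_univ_eq_sum_range (fun i => c i • ξ i) n, Finsupp.sum]
  symm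
  apply Finset.sum_subset
  · intro i hi
    have : i ≤ c.support.sup id := Finset.le_sup (f := id) hi
    simp; omega
  · intro i _ hi
    simp [Finsupp.notMem_support_iff.1 hi]

/-- Filter version of Hadamard differentiability. -/
def HF (f : X → ℝ) (x : X) (L : X →L[ℝ] ℝ) : Prop :=
  ∀ h : X, Tendsto (fun p : ℝ × X => (f (x + p.1 • p.2) - f x) / p.1) (𝓝[≠] 0 ×ˢ 𝓝 h) (𝓝 (L h))

lemma HF.hadamard {f : X → ℝ} {x : X} {L : X →L[ℝ] ℝ} (h : HF f x L) : HadamardDiffAt f x := by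
  refine ⟨L, fun v t ht ht0 hs hhs => ?_⟩
  have : Tendsto (fun n => (t n, hs n)) atTop (𝓝[≠] 0 ×ˢ 𝓝 v) :=
    Tendsto.prodMk (tendsto_nhdsWithin_iff.2 ⟨ht0, Eventually.of_forall ht⟩) hhs
  have h2 := Tendsto.comp (h v) this
  simpa only [Function.comp_def] using h2

lemma HF.line {f : X → ℝ} {x : X} {L : X →L[ℝ] ℝ} (h : HF f x L) (v : X) :
    Tendsto (fun t : ℝ => (f (x + t • v) - f x) / t) (𝓝[≠] 0) (𝓝 (L v)) := by
  have : Tendsto (fun t : ℝ => (t, v)) (𝓝[≠] 0) (𝓝[≠] 0 ×ˢ 𝓝 v) :=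
    Tendsto.prodMk tendsto_id tendsto_const_nhds
  have h2 := Tendsto.comp (h v) this
  simpa only [Function.comp_def] using h2

lemma hasLineDerivAt_iff' {f : X → ℝ} {x v : X} {a : ℝ} :
    HasLineDerivAt ℝ f a x v ↔
    Tendsto (fun t : ℝ => (f (x + t • v) - f x) / t) (𝓝[≠] 0) (𝓝 a) := by
  unfold HasLineDerivAt
  rw [hasDerivAt_iff_tendsto_slope_zero]
  simp [div_eq_inv_mul]

lemma HF.squeeze {f u v : X → ℝ} {x : X} {Lu Lv : X →L[ℝ] ℝ} (hu : HF u x Lu) (hv : HF v x Lv)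
    (hux : u x = f x) (hvx : v x = f x) (h : ∀ᶠ y in 𝓝 x, u y ≤ f y ∧ f y ≤ v y) :
    HF f x Lv := by
  have hmap : ∀ k : X, Tendsto (fun p : ℝ × X => x + p.1 • p.2) (𝓝[≠] 0 ×ˢ 𝓝 k) (𝓝 x) := by
    intro k
    have h1 : Tendsto (fun p : ℝ × X => x + p.1 • p.2) (𝓝 (0, k)) (𝓝 (x + (0:ℝ) • k)) := by
      apply Continuous.tendsto (f := fun p : ℝ × X => x + p.1 • p.2)
      fun_prop
    rw [zero_smul, add_zero, nhds_prod_eq] at h1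
    exact h1.mono_left (Filter.prod_mono_left _ nhdsWithin_le_nhds)
  have key : ∀ k, Lu k ≤ Lv k := by
    intro k
    have h1 := (hu.line k).mono_left (nhdsWithin_mono 0 (s := Ioi 0) (fun t (ht : t ∈ Ioi 0) => ne_of_gt ht))
    have h2 := (hv.line k).mono_left (nhdsWithin_mono 0 (s := Ioi 0) (fun t (ht : t ∈ Ioi 0) => ne_of_gt ht))
    refine le_of_tendsto_of_tendsto h1 h2 ?_
    have h3 : Tendsto (fun t : ℝ => x + t • k) (𝓝[>] 0) (𝓝 x) := by
      have : Tendsto (fun t : ℝ => x + t • k) (𝓝 0) (𝓝 (x + (0:ℝ) • k)) := by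
        apply Continuous.tendsto (f := fun t : ℝ => x + t • k)
        fun_prop
      rw [zero_smul, add_zero] at this
      exact this.mono_left nhdsWithin_le_nhds
    filter_upwards [h3.eventually h, self_mem_nhdsWithin] with t ht ht0
    have : (0:ℝ) < t := ht0
    gcongr
    · exact ht.1.trans ht.2
    · rw [hux, hvx]
  have heq : Lu = Lv := by
    ext k
    refine le_antisymm (key k) ?_
    have := key (-k)
    simp at this
    exact this
  subst heq
  intro k
  have hz : Tendsto (fun p : ℝ × X => (v (x + p.1 • p.2) - v x) / p.1 - (u (x + p.1 • p.2) - u x) / p.1)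
      (𝓝[≠] 0 ×ˢ 𝓝 k) (𝓝 0) := by
    simpa using (hv k).sub (hu k)
  have hz2 : Tendsto (fun p : ℝ × X => (v (x + p.1 • p.2) - v x) / p.1 - (f (x + p.1 • p.2) - f x) / p.1)
      (𝓝[≠] 0 ×ˢ 𝓝 k) (𝓝 0) := by
    refine squeeze_zero_norm' (a := fun p : ℝ × X =>
      ‖(v (x + p.1 • p.2) - v x) / p.1 - (u (x + p.1 • p.2) - u x) / p.1‖) ?_ (by simpa using hz.norm)
    filter_upwards [(hmap k).eventually h] with p hp
    rw [hux, hvx, ← sub_div, ← sub_div, norm_div, norm_div]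
    gcongr
    rw [Real.norm_eq_abs, Real.norm_eq_abs, abs_of_nonneg (by linarith), abs_of_nonneg (by linarith)]
    linarith
  simpa using (hv k).sub hz2

end Aux2

section Aux3

open scoped NNReal

variable {X : Type*} [NormedAddCommGroup X] [NormedSpace ℝ X]

lemma lip_HF_of_dense {g : X → ℝ} {C : ℝ≥0} (hg : LipschitzWith C g) {x : X} {S : Set X}
    (hS : Dense S) (L : X →L[ℝ] ℝ) (hL : ∀ v ∈ S, HasLineDerivAt ℝ g (L v) x v) : HF g x L := by
  intro h
  rw [Metric.tendsto_nhds]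
  intro ε hε
  obtain ⟨δ, hδ, hδε⟩ : ∃ δ : ℝ, 0 < δ ∧ (2 * C + ‖L‖ + 1) * δ = ε :=
    ⟨ε / (2 * C + ‖L‖ + 1), by positivity, mul_div_cancel₀ ε (by positivity)⟩
  obtain ⟨s, hsS, hs⟩ := hS.exists_dist_lt h hδ
  have h1 := hasLineDerivAt_iff'.1 (hL s hsS)
  rw [Metric.tendsto_nhds] at h1
  have h2 : ∀ᶠ t : ℝ in 𝓝[≠] 0, dist ((g (x + t • s) - g x) / t) (L s) < δ ∧ t ≠ 0 :=
    (h1 δ hδ).and self_mem_nhdsWithin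
  have h3 : ∀ᶠ k in 𝓝 h, dist k h < δ := Metric.ball_mem_nhds h hδ
  filter_upwards [h2.prod_mk h3] with p hp
  obtain ⟨⟨hp1, hp0⟩, hp2⟩ := hp
  have e1 : dist ((g (x + p.1 • p.2) - g x) / p.1) ((g (x + p.1 • s) - g x) / p.1) ≤ C * (2 * δ) := by
    rw [Real.dist_eq, ← sub_div, abs_div, div_le_iff₀ (abs_pos.2 hp0)]
    have := hg.dist_le_mul (x + p.1 • p.2) (x + p.1 • s)
    rw [dist_add_left, dist_smul₀, Real.dist_eq, Real.norm_eq_abs] at this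
    have h4 : dist p.2 s ≤ 2 * δ := by
      have := dist_triangle p.2 h s
      linarith
    calc _ = |g (x + p.1 • p.2) - g (x + p.1 • s)| := by congr 1; ring
      _ ≤ C * (|p.1| * dist p.2 s) := this
      _ ≤ C * (|p.1| * (2 * δ)) := by gcongr
      _ = _ := by ring
  have e2 : dist (L s) (L h) ≤ ‖L‖ * δ := by
    rw [dist_eq_norm, ← map_sub]
    refine (L.le_opNorm _).trans ?_
    gcongr
    rw [← dist_eq_norm, dist_comm]
    exact hs.le
  calc _ ≤ _ := dist_triangle4 _ ((g (x + p.1 • s) - g x) / p.1) (L s) _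
    _ < C * (2 * δ) + δ + ‖L‖ * δ := by linarith
    _ = ε := by rw [← hδε]; ring

lemma lip_HF_of_span {g : X → ℝ} {C : ℝ≥0} (hg : LipschitzWith C g) {x : X} {ξ : ℕ → X}
    (hξ : Dense (Submodule.span ℝ (Set.range ξ) : Set X))
    (hd : ∀ n, DifferentiableAt ℝ (fun t : Fin n → ℝ => g (x + ∑ i, t i • ξ i)) 0) :
    ∃ L, HF g x L := by
  have key : ∀ n, ∃ A : (Fin n → ℝ) →L[ℝ] ℝ, ∀ t : Fin n → ℝ,
      HasLineDerivAt ℝ g (A t) x (∑ i, t i • ξ i) := by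
    intro n
    refine ⟨fderiv ℝ (fun t : Fin n → ℝ => g (x + ∑ i, t i • ξ i)) 0, fun t => ?_⟩
    have := (hd n).hasFDerivAt.hasLineDerivAt t
    unfold HasLineDerivAt at this ⊢
    simpa [Finset.smul_sum, mul_smul] using this
  choose A hA using key
  set S := Submodule.span ℝ (Set.range ξ)
  have hrep : ∀ h ∈ S, HasLineDerivAt ℝ g (lineDeriv ℝ g x h) x h := by
    intro h hh
    obtain ⟨c, n, hc⟩ := mem_span_rep hh
    have := hA n (fun i => c i)
    rw [hc n le_rfl] at this
    exact this.lineDifferentiableAt.hasLineDerivAt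
  let ℓ : S →ₗ[ℝ] ℝ :=
    { toFun := fun h => lineDeriv ℝ g x (h : X)
      map_add' := by
        rintro ⟨a, ha⟩ ⟨b, hb⟩
        obtain ⟨c, n, hc⟩ := mem_span_rep ha
        obtain ⟨c', n', hc'⟩ := mem_span_rep hb
        have h1 := hA (max n n') (fun i => c i)
        have h2 := hA (max n n') (fun i => c' i)
        have h3 := hA (max n n') ((fun i => c i : Fin (max n n') → ℝ) + (fun i => c' i : Fin (max n n') → ℝ))
        simp only [Pi.add_apply, add_smul, Finset.sum_add_distrib] at h3
        rw [hc _ (le_max_left _ _)] at h1 h3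
        rw [hc' _ (le_max_right _ _)] at h2 h3
        simp only [Submodule.coe_add]
        rw [h1.lineDeriv, h2.lineDeriv, h3.lineDeriv, map_add]
      map_smul' := by
        rintro r ⟨a, ha⟩
        simp only [SetLike.val_smul, RingHom.id_apply]
        rw [lineDeriv_smul] }
  have hb : ∀ h : S, ‖ℓ h‖ ≤ C * ‖h‖ := fun h =>
    norm_lineDeriv_le_of_lipschitz ℝ hg
  obtain ⟨L, hL, -⟩ := exists_extension_norm_eq S (ℓ.mkContinuous C hb)
  refine ⟨L, lip_HF_of_dense hg hξ L fun v hv => ?_⟩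
  rw [hL ⟨v, hv⟩]
  exact hrep v hv

lemma lip_comp {g : X → ℝ} {C : ℝ≥0} (hg : LipschitzWith C g) (x : X) (ξ : ℕ → X) (n : ℕ) :
    ∃ C', LipschitzWith C' (fun t : Fin n → ℝ => g (x + ∑ i, t i • ξ i)) := by
  let A : (Fin n → ℝ) →L[ℝ] X := ∑ i : Fin n, (ContinuousLinearMap.proj (R := ℝ) (φ := fun _ : Fin n => ℝ) i).smulRight (ξ i)
  have hA : ∀ t, A t = ∑ i, t i • ξ i := by intro t; simp [A]
  refine ⟨C * ‖A‖₊, LipschitzWith.of_dist_le_mul fun s t => ?_⟩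
  refine (hg.dist_le_mul _ _).trans ?_
  rw [dist_add_left, ← hA, ← hA, NNReal.coe_mul, mul_assoc]
  gcongr
  exact A.lipschitz.dist_le_mul s t

lemma diff_of_HF {g : X → ℝ} {C : ℝ≥0} (hg : LipschitzWith C g) {x : X} {L : X →L[ℝ] ℝ}
    (h : HF g x L) (ξ : ℕ → X) (n : ℕ) :
    DifferentiableAt ℝ (fun t : Fin n → ℝ => g (x + ∑ i, t i • ξ i)) 0 := by
  let A : (Fin n → ℝ) →L[ℝ] X := ∑ i : Fin n, (ContinuousLinearMap.proj (R := ℝ) (φ := fun _ : Fin n => ℝ) i).smulRight (ξ i)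
  have hA : ∀ t, A t = ∑ i, t i • ξ i := by intro t; simp [A]
  obtain ⟨C', hC'⟩ := lip_comp hg x ξ n
  refine (hC'.hasFDerivAt_of_hasLineDerivAt_of_closure (s := univ) (by simp) (L := L.comp A)
    fun v _ => ?_).differentiableAt
  have h2 := hasLineDerivAt_iff'.2 (h.line (A v))
  unfold HasLineDerivAt at h2 ⊢
  simp only [← hA]
  simpa using h2

variable [MeasurableSpace X] [BorelSpace X] [SecondCountableTopology X]

lemma lip_aronszajn {g : X → ℝ} {C : ℝ≥0} (hg : LipschitzWith C g) :
    ∃ N : Set X, AronszajnNull N ∧ ∀ x ∉ N, ∃ L, HF g x L := by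
  let D : (ℕ → X) → ℕ → Set X := fun ξ n =>
    {x | ¬ DifferentiableAt ℝ (fun t : Fin n → ℝ => g (x + ∑ i, t i • ξ i)) 0}
  have hDm : ∀ ξ n, MeasurableSet (D ξ n) := by
    intro ξ n
    have hc : Continuous (Function.uncurry fun (x : X) (t : Fin n → ℝ) => g (x + ∑ i, t i • ξ i)) := by
      unfold Function.uncurry
      have := hg.continuous
      fun_prop
    have h1 := (measurableSet_of_differentiableAt_with_param ℝ hc).compl
    have h2 : Measurable fun x : X => (x, (0 : Fin n → ℝ)) := by fun_prop
    exact h2 h1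
  have hDnull : ∀ ξ n, NullFor ξ n (D ξ n) := by
    intro ξ n x
    obtain ⟨C', hC'⟩ := lip_comp hg x ξ n
    have := hC'.ae_differentiableAt (μ := volume)
    refine measure_mono_null ?_ this
    intro t ht htd
    apply ht
    have htd' : DifferentiableAt ℝ (fun t : Fin n → ℝ => g (x + ∑ i, t i • ξ i)) (0 + t) := by
      rw [zero_add]
      exact htd
    have h3 : DifferentiableAt ℝ (fun s : Fin n → ℝ => g (x + ∑ i, (s + t) i • ξ i)) 0 :=
      DifferentiableAt.comp (g := fun t : Fin n → ℝ => g (x + ∑ i, t i • ξ i))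
        (f := fun s => s + t) 0 htd' (by fun_prop)
    convert h3 using 3 with s
    simp [add_smul, Finset.sum_add_distrib]
    abel
  let d : ℕ → X := TopologicalSpace.denseSeq X
  have hd : Dense (Submodule.span ℝ (Set.range d) : Set X) :=
    (TopologicalSpace.denseRange_denseSeq X).mono Submodule.subset_span
  have hNm : MeasurableSet (⋃ n, D d n) := MeasurableSet.iUnion fun n => hDm d n
  refine ⟨⋃ n, D d n, ⟨hNm, fun ξ hξ => ?_⟩, ?_⟩
  · have hsub : (⋃ n, D d n) = (⋃ n, D d n) ∩ ⋃ n, D ξ n := by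
      rw [eq_comm, inter_eq_left]
      intro x hx
      by_contra hx2
      obtain ⟨L, hL⟩ := lip_HF_of_span hg (x := x) hξ (fun n => by
        by_contra h
        exact hx2 (mem_iUnion.2 ⟨n, h⟩))
      obtain ⟨n, hn⟩ := mem_iUnion.1 hx
      exact hn (diff_of_HF hg hL d n)
    have : Dec ξ ((⋃ n, D d n) ∩ ⋃ n, D ξ n) :=
      (Dec.iUnion fun n => NullFor.dec n _ (hDm ξ n) (hDnull ξ n)).inter hNm
    rw [← hsub] at this
    exact this
  · intro x hx
    refine lip_HF_of_span hg hd fun n => ?_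
    by_contra h
    exact hx (mem_iUnion.2 ⟨n, h⟩)

end Aux3

section Aux4

open scoped NNReal

variable {X : Type*} [NormedAddCommGroup X] [NormedSpace ℝ X]

lemma envelope (f : X → ℝ) (B : Set X) (C : ℝ≥0) :
    ∃ v : X → ℝ, LipschitzWith C v ∧ ∀ x ∈ B, (∀ y ∈ B, |f y - f x| ≤ C * dist y x) →
      v x = f x ∧ ∀ y ∈ B, f y ≤ v y := by
  let A : Set X := {x | x ∈ B ∧ ∀ y ∈ B, |f y - f x| ≤ C * dist y x}
  by_cases hA : A.Nonempty
  · obtain ⟨x₀, hx₀⟩ := hA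
    have : Nonempty A := ⟨⟨x₀, hx₀⟩⟩
    have hbdd : ∀ z : X, BddBelow (range fun x : A => f x + C * dist z x) := by
      intro z
      refine ⟨f x₀ - C * dist z x₀, ?_⟩
      rintro _ ⟨⟨x, hx⟩, rfl⟩
      have h1 := (abs_le.1 (hx₀.2 x hx.1)).1
      have h2 := dist_triangle_left x x₀ z
      have h3 : (C : ℝ) * dist x x₀ ≤ C * (dist z x + dist z x₀) := by gcongr
      simp only
      linarith
    refine ⟨fun z => ⨅ x : A, f x + C * dist z x, LipschitzWith.of_le_add_mul C fun z w => ?_,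
      fun x hxB hx => ⟨le_antisymm ?_ ?_, fun y hy => ?_⟩⟩
    · rw [← sub_le_iff_le_add]
      refine le_ciInf fun x => ?_
      have h1 := ciInf_le (hbdd z) x
      have h2 : (C : ℝ) * dist z x ≤ C * (dist z w + dist w x) := by
        gcongr
        exact dist_triangle _ _ _
      linarith
    · have := ciInf_le (hbdd x) ⟨x, hxB, hx⟩
      simpa using this
    · refine le_ciInf fun a => ?_
      have := (abs_le.1 (a.2.2 x hxB)).2
      linarith
    · refine le_ciInf fun a => ?_
      have := (abs_le.1 (a.2.2 y hy)).2
      linarith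
  · refine ⟨fun _ => 0, LipschitzWith.const' 0, fun x hxB hx => ?_⟩
    exact absurd ⟨x, hxB, hx⟩ hA

lemma envelope' (f : X → ℝ) (B : Set X) (C : ℝ≥0) :
    ∃ v : X → ℝ, LipschitzWith C v ∧ ∀ x ∈ B, (∀ y ∈ B, |f y - f x| ≤ C * dist y x) →
      v x = f x ∧ ∀ y ∈ B, v y ≤ f y := by
  obtain ⟨v, hv, h⟩ := envelope (fun x => - f x) B C
  refine ⟨fun x => - v x, hv.neg, fun x hx hxB => ?_⟩
  have := h x hx (fun y hy => by
    have := hxB y hy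
    rw [abs_sub_comm] at this
    convert this using 2
    ring)
  refine ⟨by simp [this.1], fun y hy => ?_⟩
  have := this.2 y hy
  linarith

/-- Points where the oscillation of `f` is controlled linearly. -/
def Good (f : X → ℝ) : Set X :=
  {x | ∃ C n : ℕ, ∀ r : ℝ, 0 < r → r < 1 / ((n : ℝ) + 1) →
    ∀ y ∈ Metric.ball x r, ∀ z ∈ Metric.ball x r, f y - f z ≤ C * r}

variable [MeasurableSpace X] [BorelSpace X]

lemma good_meas (f : X → ℝ) : MeasurableSet (Good f) := by
  have : Good f = ⋃ (C : ℕ) (n : ℕ), {x | ∀ r : ℝ, 0 < r → r < 1 / ((n : ℝ) + 1) →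
    ∀ y ∈ Metric.ball x r, ∀ z ∈ Metric.ball x r, f y - f z ≤ C * r} := by
    ext x; simp [Good]
  rw [this]
  refine MeasurableSet.iUnion fun C => MeasurableSet.iUnion fun n => IsClosed.measurableSet ?_
  rw [← isOpen_compl_iff, isOpen_iff_mem_nhds]
  intro x hx
  simp only [mem_compl_iff, mem_ofPred_eq, not_forall] at hx
  obtain ⟨r, hr, hrn, y, hy, z, hz, h⟩ := hx
  have h1 : ∀ᶠ x' in 𝓝 x, dist y x' < r :=
    (Continuous.tendsto (f := fun x' => dist y x') (by fun_prop) x).eventually_lt_const hy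
  have h2 : ∀ᶠ x' in 𝓝 x, dist z x' < r :=
    (Continuous.tendsto (f := fun x' => dist z x') (by fun_prop) x).eventually_lt_const hz
  filter_upwards [h1, h2] with x' h1 h2
  simp only [mem_compl_iff, mem_ofPred_eq]
  exact fun hc => h (hc r hr hrn y h1 z h2)

lemma AronszajnNull.iUnion' {ι : Type*} [Countable ι] {N : ι → Set X}
    (h : ∀ i, AronszajnNull (N i)) : AronszajnNull (⋃ i, N i) :=
  ⟨MeasurableSet.iUnion fun i => (h i).1, fun ξ hξ => Dec.iUnion fun i => (h i).2 ξ hξ⟩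

lemma AronszajnNull.union' {N M : Set X} (hN : AronszajnNull N) (hM : AronszajnNull M) :
    AronszajnNull (N ∪ M) :=
  ⟨hN.1.union hM.1, fun ξ hξ => Dec.union (hN.2 ξ hξ) (hM.2 ξ hξ)⟩

variable [SecondCountableTopology X]

lemma good_hadamard (f : X → ℝ) :
    ∃ N : Set X, AronszajnNull N ∧ ∀ x ∈ Good f, x ∉ N → HadamardDiffAt f x := by
  let d : ℕ → X := TopologicalSpace.denseSeq X
  let B : ℕ × ℕ × ℕ → Set X := fun p => Metric.ball (d p.1) (1 / ((p.2.1 : ℝ) + 1))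
  choose v hv hv2 using fun p : ℕ × ℕ × ℕ => envelope f (B p) (p.2.2 : ℝ≥0)
  choose u hu hu2 using fun p : ℕ × ℕ × ℕ => envelope' f (B p) (p.2.2 : ℝ≥0)
  choose Nv hNv hNv2 using fun p => lip_aronszajn (hv p)
  choose Nu hNu hNu2 using fun p => lip_aronszajn (hu p)
  refine ⟨(⋃ p, Nv p) ∪ ⋃ p, Nu p,
    (AronszajnNull.iUnion' hNv).union' (AronszajnNull.iUnion' hNu), ?_⟩
  rintro x ⟨C, n, hx⟩ hxN
  simp only [mem_union, mem_iUnion, not_or, not_exists] at hxN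
  have hj : (0 : ℝ) < 1 / (((4 * n + 4 : ℕ) : ℝ) + 1) := by positivity
  obtain ⟨k, hk⟩ := (TopologicalSpace.denseRange_denseSeq X).exists_dist_lt x hj
  let p : ℕ × ℕ × ℕ := (k, 4 * n + 4, 2 * C)
  have hxB : x ∈ B p := hk
  have hLip : ∀ y ∈ B p, |f y - f x| ≤ ((p.2.2 : ℝ≥0) : ℝ) * dist y x := by
    intro y hy
    rcases eq_or_ne y x with rfl | hne
    · simp
    have hpos := dist_pos.2 hne
    have h1 : dist y x < 2 * (1 / (((4 * n + 4 : ℕ) : ℝ) + 1)) := by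
      have h2 : dist y (d k) < 1 / (((4 * n + 4 : ℕ) : ℝ) + 1) := hy
      have := dist_triangle_right y x (d k)
      have hk' : dist x (d k) < 1 / (((4 * n + 4 : ℕ) : ℝ) + 1) := hk
      linarith
    have h2 : 4 * (1 / (((4 * n + 4 : ℕ) : ℝ) + 1)) ≤ 1 / ((n : ℝ) + 1) := by
      rw [← mul_div_assoc, div_le_div_iff₀ (by positivity) (by positivity)]
      push_cast
      linarith
    have h3 := hx (2 * dist y x) (by positivity) (by linarith)
    have hyb : y ∈ Metric.ball x (2 * dist y x) := by
      rw [Metric.mem_ball]; linarith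
    have hxb : x ∈ Metric.ball x (2 * dist y x) := Metric.mem_ball_self (by positivity)
    have h4 := h3 y hyb x hxb
    have h5 := h3 x hxb y hyb
    rw [abs_le]
    simp only [p]
    push_cast
    constructor <;> linarith
  obtain ⟨hvx, hvB⟩ := hv2 p x hxB hLip
  obtain ⟨hux, huB⟩ := hu2 p x hxB hLip
  obtain ⟨Lv, hLv⟩ := hNv2 p x (hxN.1 p)
  obtain ⟨Lu, hLu⟩ := hNu2 p x (hxN.2 p)
  refine (HF.squeeze hLu hLv hux hvx ?_).hadamard
  filter_upwards [Metric.isOpen_ball.mem_nhds hxB] with y hy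
  exact ⟨huB y hy, hvB y hy⟩

lemma local_null {f : X → ℝ} {V : Set X} (hV : IsOpen V) {a : X} {r : ℝ} (hr : 0 < r)
    (hmono : ∀ y ∈ V, ∀ b ∈ Metric.ball a r, ∀ s : ℝ, 0 ≤ s → f y ≤ f (y + s • (y - b)))
    (p : X) : AronszajnNull ((V ∩ Metric.ball p (r / 4)) \ Good f) := by
  set W := V ∩ Metric.ball p (r / 4) with hW
  have hWo : IsOpen W := hV.inter Metric.isOpen_ball
  have hSm : MeasurableSet (W \ Good f) := hWo.measurableSet.diff (good_meas f)
  refine ⟨hSm, fun ξ hξ => ?_⟩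
  obtain ⟨e, he, hpe⟩ := hξ.exists_dist_lt (p - a) (ε := r / 4) (by positivity)
  have hmono' : ∀ y ∈ W, ∀ w : X, ‖w - e‖ < r / 2 → ∀ s : ℝ, 0 ≤ s → f y ≤ f (y + s • w) := by
    intro y hy w hw s hs
    have hb : y - w ∈ Metric.ball a r := by
      rw [Metric.mem_ball, dist_eq_norm]
      have h1 : ‖y - p‖ < r / 4 := by rw [← dist_eq_norm]; exact hy.2
      rw [dist_eq_norm] at hpe
      have h2 : y - w - a = (y - p) + (p - a - e) - (w - e) := by abel
      rw [h2]
      have h3 := norm_sub_le ((y - p) + (p - a - e)) (w - e)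
      have h4 := norm_add_le (y - p) (p - a - e)
      linarith
    simpa using hmono y hy.1 (y - w) hb s hs
  obtain ⟨c, n, hc⟩ := mem_span_rep he
  have hnull : NullFor ξ n (W \ Good f) := by
    refine nullFor_of_line hSm (fun i => c i) fun x => ?_
    rw [hc n le_rfl]
    set T : Set ℝ := {t | x + t • e ∈ W}
    have hTo : IsOpen T := hWo.preimage (f := fun t : ℝ => x + t • e) (by fun_prop)
    have hm : MonotoneOn (fun t : ℝ => f (x + t • e)) T := by
      intro t ht t' _ htt'
      have := hmono' _ ht e (by simpa using hr) (t' - t) (sub_nonneg.2 htt')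
      have h0 : x + t • e + (t' - t) • e = x + t' • e := by rw [sub_smul]; abel
      rw [h0] at this
      exact this
    refine measure_mono_null ?_ hm.ae_differentiableWithinAt_of_mem
    rintro t ⟨htW, htG⟩ hdiff
    apply htG
    have hd : DifferentiableAt ℝ (fun t : ℝ => f (x + t • e)) t :=
      (hdiff htW).differentiableAt (hTo.mem_nhds htW)
    obtain ⟨K, hK⟩ := hd.isBigO_sub.bound
    obtain ⟨ε₁, hε₁, h1⟩ := Metric.eventually_nhds_iff.1 (hK.and (hTo.mem_nhds htW))
    obtain ⟨ε₂, hε₂, h2⟩ := Metric.isOpen_iff.1 hWo _ htW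
    obtain ⟨n, hn⟩ := exists_nat_one_div_lt (K := ℝ) (ε := min (ε₁ * (r / 4)) ε₂) (by positivity)
    obtain ⟨C, hC⟩ := exists_nat_ge (2 * K * (4 / r))
    refine ⟨C, n, fun ρ hρ hρn y hy z hz => ?_⟩
    set σ := 4 / r * ρ with hσ
    have hσ0 : 0 < σ := by positivity
    have hσρ : ρ / σ = r / 4 := by rw [hσ]; field_simp
    have hσε : σ < ε₁ := by
      have : ρ < ε₁ * (r / 4) := (hρn.trans hn).trans_le (min_le_left _ _)
      rw [hσ, div_mul_eq_mul_div, div_lt_iff₀ hr]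
      linarith
    have hyW : y ∈ W := h2 (Metric.ball_subset_ball
      ((hρn.trans hn).le.trans (min_le_right _ _)) hy)
    have hp := h1 (y := t + σ) (by simpa [abs_of_pos hσ0] using hσε)
    have hq := h1 (y := t - σ) (by simpa [abs_of_pos hσ0] using hσε)
    have hsmall : ∀ w : X, ‖w‖ < ρ → ‖(e + σ⁻¹ • w) - e‖ < r / 2 := by
      intro w hw
      rw [add_sub_cancel_left, norm_smul, norm_inv, Real.norm_eq_abs, abs_of_pos hσ0,
        ← div_eq_inv_mul]
      calc ‖w‖ / σ < ρ / σ := by gcongr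
        _ = r / 4 := hσρ
        _ < r / 2 := by linarith
    have e1 : f y ≤ f (x + (t + σ) • e) := by
      have := hmono' y hyW (e + σ⁻¹ • (x + t • e - y)) (hsmall _ (by
        rw [← dist_eq_norm, dist_comm]; exact hy)) σ hσ0.le
      convert this using 2
      rw [smul_add, smul_inv_smul₀ hσ0.ne', add_smul]
      abel
    have e2 : f (x + (t - σ) • e) ≤ f z := by
      have := hmono' _ hq.2 (e + σ⁻¹ • (z - (x + t • e))) (hsmall _ (by
        rw [← dist_eq_norm]; exact hz)) σ hσ0.le
      convert this using 2
      rw [smul_add, smul_inv_smul₀ hσ0.ne', sub_smul]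
      abel
    have e3 := (abs_le.1 hp.1).2
    have e4 := (abs_le.1 hq.1).1
    simp only [add_sub_cancel_left, sub_sub_cancel_left, norm_neg, Real.norm_eq_abs,
      abs_of_pos hσ0] at e3 e4
    have e5 : 2 * K * (4 / r) * ρ ≤ C * ρ := by gcongr
    have e6 : 2 * K * (4 / r) * ρ = 2 * (K * σ) := by rw [hσ]; ring
    linarith
  exact NullFor.dec n _ hSm hnull

end Aux4

/-- If `{f < m}` is nowhere dense, then `f` is Hadamard differentiable on an open dense
set except at the points of an Aronszajn null set. -/
theorem stmt_13 {X : Type*} [NormedAddCommGroup X] [NormedSpace ℝ X] [CompleteSpace X]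
    [TopologicalSpace.SeparableSpace X] [MeasurableSpace X] [BorelSpace X]
    (f : X → ℝ) (hq : QuasiconvexFun f) (hd : DenselyContinuous f)
    (m : ℝ) (hm : IsTopEssInf f m)
    (hnd : IsNowhereDense {x : X | f x < m}) :
    ∃ U : Set X, IsOpen U ∧ Dense U ∧
      ∃ N : Set X, AronszajnNull N ∧ ∀ x ∈ U \ N, HadamardDiffAt f x := by
  classical
  have : SecondCountableTopology X := UniformSpace.secondCountable_of_separable X
  have hconv : ∀ α : ℝ, Convex ℝ {x | f x < α} := by
    intro α x hx y hy a b ha hb hab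
    have hb' : b = 1 - a := by linarith
    subst hb'
    exact (hq x y a ⟨ha, by linarith⟩).trans_lt (max_lt hx hy)
  have hint : ∀ α : ℝ, m < α → (interior {x | f x < α}).Nonempty := by
    intro α hα
    obtain ⟨β, hβ1, hβ2⟩ := exists_between hα
    have h1 : (interior (closure {x | f x < β})).Nonempty := by
      by_contra h
      exact hm.2 β hβ1 (IsNowhereDense.isMeagre (not_nonempty_iff_eq_empty.1 h))
    obtain ⟨x, hxc, hxi⟩ := hd.exists_mem_open isOpen_interior h1
    have hxc' : ContinuousAt f x := hxc
    have h2 : f x ≤ β := by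
      by_contra! hlt
      have h3 : ∀ᶠ y in 𝓝 x, β < f y := hxc'.eventually_const_lt hlt
      obtain ⟨y, hy1, hy2⟩ := (mem_closure_iff_frequently.1 (interior_subset hxi)).and_eventually h3 |>.exists
      exact lt_asymm hy1 hy2
    refine ⟨x, mem_interior_iff_mem_nhds.2 ?_⟩
    have h5 : ∀ᶠ y in 𝓝 x, f y < α := hxc'.eventually_lt_const (h2.trans_lt hβ2)
    filter_upwards [h5] with y hy using hy
  let α : ℕ → ℝ := fun n => m + 1 / ((n : ℝ) + 1)
  have hα : ∀ n, m < α n := fun n => by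
    have : (0 : ℝ) < 1 / ((n : ℝ) + 1) := by positivity
    simp only [α]; linarith
  have hball : ∀ n, ∃ a : X, ∃ r : ℝ, 0 < r ∧ Metric.ball a r ⊆ {x | f x < α n} := by
    intro n
    obtain ⟨a, ha⟩ := hint _ (hα n)
    obtain ⟨r, hr, h⟩ := Metric.isOpen_iff.1 isOpen_interior a ha
    exact ⟨a, r, hr, h.trans interior_subset⟩
  choose a r hr hab using hball
  let D : Set X := ⋂ n, closure {x | f x < α n}
  have hDc : IsClosed D := isClosed_iInter fun n => isClosed_closure
  have hDint : ∀ x ∈ interior D, f x ≤ m := by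
    intro x hx
    have h1 : ∀ n, f x < α n := by
      intro n
      have h2 : x ∈ interior (closure {x | f x < α n}) :=
        interior_mono (iInter_subset _ n) hx
      rw [(hconv (α n)).interior_closure_eq_interior_of_nonempty_interior (hint _ (hα n))] at h2
      have h3 : x ∈ {x | f x < α n} := interior_subset h2
      exact h3
    by_contra! hlt
    obtain ⟨n, hn⟩ := exists_nat_one_div_lt (sub_pos.2 hlt)
    have := h1 n
    simp only [α] at this
    linarith
  let d : ℕ → X := TopologicalSpace.denseSeq X
  let V : ℕ → Set X := fun n => (closure {x | f x < α n})ᶜ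
  have hmono : ∀ n, ∀ y ∈ V n, ∀ b ∈ Metric.ball (a n) (r n), ∀ s : ℝ, 0 ≤ s →
      f y ≤ f (y + s • (y - b)) := by
    intro n y hy b hb s hs
    have hfb : f b < α n := hab n hb
    have hfy : α n ≤ f y := by
      by_contra! h
      exact hy (subset_closure h)
    have h1 := hq (y + s • (y - b)) b (1 / (1 + s)) ⟨by positivity, by
      rw [div_le_one (by positivity)]; linarith⟩
    have h2 : (1 / (1 + s)) • (y + s • (y - b)) + (1 - 1 / (1 + s)) • b = y := by
      have hs1 : (1 + s) ≠ 0 := by positivity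
      have h3 : (1 - 1 / (1 + s)) = (1 / (1 + s)) * s := by field_simp; ring
      have h4 : y + s • (y - b) = (1 + s) • y - s • b := by
        rw [smul_sub, add_smul, one_smul]; abel
      rw [h3, h4, mul_smul, smul_sub, smul_smul, one_div, inv_mul_cancel₀ hs1, one_smul]
      abel
    rw [h2] at h1
    rcases le_max_iff.1 h1 with h | h
    · exact h
    · linarith
  obtain ⟨N₁, hN₁, hN₁'⟩ := good_hadamard f
  have hloc : ∀ p : ℕ × ℕ,
      AronszajnNull ((V p.1 ∩ Metric.ball (d p.2) (r p.1 / 4)) \ Good f) := by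
    intro p
    have hVo : IsOpen (V p.1) := isClosed_closure.isOpen_compl
    exact local_null hVo (hr p.1) (hmono p.1) (d p.2)
  have hUn := AronszajnNull.iUnion' hloc
  have hUo : IsOpen (interior D \ closure {x | f x < m}) := isOpen_interior.sdiff isClosed_closure
  refine ⟨(interior D \ closure {x | f x < m}) ∪ Dᶜ,
    hUo.union hDc.isOpen_compl, ?_,
    (⋃ p : ℕ × ℕ, (V p.1 ∩ Metric.ball (d p.2) (r p.1 / 4)) \ Good f) ∪ N₁,
    hUn.union' hN₁, ?_⟩
  · rw [dense_iff_inter_open]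
    intro O hO hOne
    by_cases h : (O ∩ Dᶜ).Nonempty
    · obtain ⟨x, hx, hx2⟩ := h
      exact ⟨x, hx, Or.inr hx2⟩
    · have hOD : O ⊆ interior D := by
        refine interior_maximal (fun x hx => ?_) hO
        by_contra hxD
        exact h ⟨x, hx, hxD⟩
      have : ¬ O ⊆ closure {x | f x < m} := by
        intro hsub
        obtain ⟨x, hx⟩ := hOne
        have h1 : x ∈ interior (closure {x | f x < m}) := interior_maximal hsub hO hx
        rw [show interior (closure {x | f x < m}) = ∅ from hnd] at h1
        exact h1
      obtain ⟨x, hx, hx2⟩ := not_subset.1 this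
      exact ⟨x, hx, Or.inl ⟨hOD hx, hx2⟩⟩
  · rintro x ⟨hxU, hxN⟩
    rw [mem_union, not_or] at hxN
    refine hN₁' x ?_ hxN.2
    rcases hxU with hx | hx
    · obtain ⟨ε, hε, hb⟩ := Metric.isOpen_iff.1 hUo x hx
      have hfm : ∀ y ∈ Metric.ball x ε, f y = m := by
        intro y hy
        refine le_antisymm (hDint y (hb hy).1) ?_
        by_contra! h
        exact (hb hy).2 (subset_closure h)
      obtain ⟨n, hn⟩ := exists_nat_one_div_lt hε
      refine ⟨0, n, fun ρ hρ hρn y hy z hz => ?_⟩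
      have hsub := Metric.ball_subset_ball (x := x) (hρn.trans hn).le
      rw [hfm y (hsub hy), hfm z (hsub hz)]
      simp
    · by_contra hG
      apply hxN.1
      simp only [D, mem_compl_iff, mem_iInter, not_forall] at hx
      obtain ⟨n, hn⟩ := hx
      obtain ⟨k, hk⟩ := (TopologicalSpace.denseRange_denseSeq X).exists_dist_lt x
        (ε := r n / 4) (by have := hr n; positivity)
      rw [mem_iUnion]
      refine ⟨(n, k), ?_⟩
      refine ⟨⟨?_, ?_⟩, hG⟩
      · exact hn
      · rw [Metric.mem_ball]
        exact hk
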